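/- Fix n ≥ 1 and a prime power q, and let m(n) = ⌊n²/4⌋ + 1. Let C(n,k,q) = |{(A₁,...,A_k) ∈ M_n(F_q)^k : A_iA_j = A_jA_i for all i,j}| be the number of k-tuples of pairwise commuting n×n matrices over F_q. Then there exist positive constants D₁, D₂ (independent of k) such that D₁ · q^{m(n)k} ≤ C(n,k,q) ≤ D₂ · q^{m(n)k} for all sufficiently large k. -/

import Mathlib

open Module in
theorem exists_common_eig {K V : Type*} [Field K] [IsAlgClosed K] [AddCommGroup V] [Module K V]
    [FiniteDimensional K V] (S : Set (Module.End K V)) (hS : ∀ f ∈ S, ∀ g ∈ S, f * g = g * f)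
    (U₀ : Submodule K V) (h0 : U₀ ≠ ⊥) (hinv : ∀ f ∈ S, ∀ x ∈ U₀, f x ∈ U₀) :
    ∃ v ∈ U₀, v ≠ 0 ∧ ∀ f ∈ S, ∃ c : K, f v = c • v := by
  obtain ⟨U, ⟨hU0, hUle, hUinv⟩, hmin⟩ := WellFounded.has_min
    (wellFounded_lt (α := Submodule K V))
    {U | U ≠ ⊥ ∧ U ≤ U₀ ∧ ∀ f ∈ S, ∀ x ∈ U, f x ∈ U} ⟨U₀, h0, le_rfl, hinv⟩
  obtain ⟨v, hvU, hv0⟩ := Submodule.exists_mem_ne_zero_of_ne_bot hU0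
  refine ⟨v, hUle hvU, hv0, fun f hf => ?_⟩
  have : Nontrivial U := Submodule.nontrivial_iff_ne_bot.mpr hU0
  obtain ⟨c, hc⟩ := Module.End.exists_eigenvalue (f.restrict (hUinv f hf))
  obtain ⟨w, hw⟩ := hc.exists_hasEigenvector
  refine ⟨c, ?_⟩
  let U' : Submodule K V := U ⊓ LinearMap.ker (f - c • (1 : Module.End K V))
  have hmem : ∀ x, x ∈ U' ↔ x ∈ U ∧ f x = c • x := by
    intro x
    simp [U', sub_eq_zero]
  have hw' : f w = c • (w : V) := by
    have := congrArg Subtype.val hw.apply_eq_smul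
    simpa using this
  have hU' : U' ≠ ⊥ := by
    refine Submodule.ne_bot_iff _ |>.mpr ⟨w, (hmem _).2 ⟨w.2, hw'⟩, ?_⟩
    simpa using hw.2
  have hnot := hmin U' ⟨hU', inf_le_left.trans hUle, fun g hg x hx => by
    rw [hmem] at hx ⊢
    refine ⟨hUinv g hg x hx.1, ?_⟩
    have := congrArg (fun h : Module.End K V => h x) (hS f hf g hg)
    simp only [Module.End.mul_apply] at this
    rw [this, hx.2, map_smul]⟩
  have : U' = U := by
    by_contra hne
    exact hnot (lt_of_le_of_ne inf_le_left hne)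
  rw [← this] at hvU
  exact ((hmem _).1 hvU).2

theorem finrank_le_of_map {K A B : Type*} [Field K] [AddCommGroup A] [Module K A]
    [FiniteDimensional K A] [AddCommGroup B] [Module K B] (W : Submodule K A)
    (L : A →ₗ[K] B) :
    Module.finrank K W = Module.finrank K (W.map L) +
      Module.finrank K (W ⊓ LinearMap.ker L : Submodule K A) := by
  have h := LinearMap.finrank_range_add_finrank_ker (L.domRestrict W)
  rw [LinearMap.range_domRestrict, LinearMap.ker_domRestrict] at h
  rw [← h]
  congr 1
  have h2 := LinearEquiv.finrank_eq (Submodule.equivMapOfInjective W.subtype W.subtype_injective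
    (Submodule.comap W.subtype (LinearMap.ker L)))
  rw [Submodule.map_comap_subtype] at h2
  exact h2

theorem schur_step_arith (n w a b : ℕ) (h1 : w ≤ n ^ 2 / 4 + 1 + a) (h2 : w ≤ n ^ 2 / 4 + 1 + b)
    (hab : a + b ≤ n + 1) : w ≤ (n + 1) ^ 2 / 4 + 1 := by
  obtain ⟨m, rfl | rfl⟩ := Nat.even_or_odd' n
  · have e1 : (2 * m) ^ 2 / 4 = m * m := by
      rw [show (2 * m) ^ 2 = 4 * (m * m) by ring]; omega
    have e2 : (2 * m + 1) ^ 2 / 4 = m * m + m := by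
      rw [show (2 * m + 1) ^ 2 = 4 * (m * m + m) + 1 by ring]; omega
    rw [e1] at h1 h2; rw [e2]; omega
  · have e1 : (2 * m + 1) ^ 2 / 4 = m * m + m := by
      rw [show (2 * m + 1) ^ 2 = 4 * (m * m + m) + 1 by ring]; omega
    have e2 : (2 * m + 1 + 1) ^ 2 / 4 = m * m + 2 * m + 1 := by
      rw [show (2 * m + 1 + 1) ^ 2 = 4 * (m * m + 2 * m + 1) by ring]; omega
    rw [e1] at h1 h2; rw [e2]; omega

open Module in
theorem schur_closed {K : Type*} [Field K] [IsAlgClosed K] (n : ℕ) :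
    ∀ (V : Type*) [AddCommGroup V] [Module K V] [FiniteDimensional K V],
      finrank K V = n → ∀ W : Submodule K (Module.End K V),
      (∀ f ∈ W, ∀ g ∈ W, f * g = g * f) → finrank K W ≤ n ^ 2 / 4 + 1 := by
  induction n with
  | zero =>
    intro V _ _ _ hV W hW
    have := Submodule.finrank_le W
    rw [Module.finrank_linearMap, hV] at this
    omega
  | succ n ih =>
    intro V _ _ _ hV W hW
    rcases Nat.eq_zero_or_pos n with rfl | hn
    · have := Submodule.finrank_le W
      rw [Module.finrank_linearMap, hV] at this
      omega
    have : Nontrivial V := Module.nontrivial_of_finrank_pos (R := K) (by omega)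
    obtain ⟨v, -, hv0, hv⟩ := exists_common_eig (W : Set (Module.End K V)) hW ⊤ top_ne_bot
      (fun _ _ _ _ => trivial)
    have hspan : finrank K (K ∙ v) = 1 := finrank_span_singleton hv0
    -- the covector
    have hann : (K ∙ v).dualAnnihilator ≠ ⊥ := by
      intro h
      have := Subspace.finrank_add_finrank_dualAnnihilator_eq (K ∙ v)
      rw [h, hspan, hV] at this
      simp at this
      omega
    have hmemann : ∀ φ : Dual K V, φ ∈ (K ∙ v).dualAnnihilator ↔ φ v = 0 := by
      intro φ
      rw [Submodule.mem_dualAnnihilator]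
      constructor
      · intro h; exact h v (Submodule.mem_span_singleton_self v)
      · intro h w hw
        obtain ⟨c, rfl⟩ := Submodule.mem_span_singleton.1 hw
        simp [h]
    obtain ⟨φ, hφv, hφ0, hφ⟩ := exists_common_eig
      (Set.image (fun f : Module.End K V => (LinearMap.dualMap f : Module.End K (Dual K V)))
        (W : Set (Module.End K V)))
      (by
        rintro _ ⟨f, hf, rfl⟩ _ ⟨g, hg, rfl⟩
        ext ψ x
        have := congrArg (fun h : Module.End K V => ψ (h x)) (hW g hg f hf)
        simpa using this)
      (K ∙ v).dualAnnihilator hann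
      (by
        rintro _ ⟨f, hf, rfl⟩ ψ hψ
        rw [hmemann] at hψ ⊢
        obtain ⟨c, hc⟩ := hv f hf
        simp [hc, hψ])
    rw [hmemann] at hφv
    have hφ' : ∀ f ∈ W, ∀ x, φ x = 0 → φ (f x) = 0 := by
      intro f hf x hx
      obtain ⟨c, hc⟩ := hφ _ ⟨f, hf, rfl⟩
      have := congrArg (fun h : Dual K V => h x) hc
      simpa [hx] using this
    obtain ⟨s, hs⟩ : ∃ s, φ s = 1 := by
      have := LinearMap.surjective hφ0
      exact this 1
    obtain ⟨ψ, hψ⟩ : ∃ ψ : Dual K V, ψ v = 1 := Module.Projective.exists_dual_eq_one K hv0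
    -- quotient
    obtain ⟨σ, hσ⟩ := (K ∙ v).mkQ.exists_rightInverse_of_surjective (Submodule.range_mkQ _)
    obtain ⟨ρ, hρ⟩ := (LinearMap.ker φ).subtype.exists_leftInverse_of_injective
      (Submodule.ker_subtype _)
    have hσ' : ∀ y, (K ∙ v).mkQ (σ y) = y := fun y => congrArg (fun h => h y) hσ
    have hρ' : ∀ y : LinearMap.ker φ, ρ y = y := fun y => congrArg (fun h => h y) hρ
    let L1 : Module.End K V →ₗ[K] Module.End K (V ⧸ (K ∙ v)) :=
      { toFun := fun f => (K ∙ v).mkQ ∘ₗ f ∘ₗ σ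
        map_add' := by intros; ext; simp
        map_smul' := by intros; ext; simp }
    let L2 : Module.End K V →ₗ[K] Module.End K (LinearMap.ker φ) :=
      { toFun := fun f => ρ ∘ₗ f ∘ₗ (LinearMap.ker φ).subtype
        map_add' := by intros; ext; simp
        map_smul' := by intros; ext; simp }
    have hL1 : ∀ f y, L1 f y = (K ∙ v).mkQ (f (σ y)) := fun _ _ => rfl
    have hL2 : ∀ f y, L2 f y = ρ (f y) := fun _ _ => rfl
    have key1 : ∀ f ∈ W, ∀ x, (K ∙ v).mkQ (f (σ ((K ∙ v).mkQ x))) = (K ∙ v).mkQ (f x) := by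
      intro f hf x
      have h1 : (K ∙ v).mkQ (σ ((K ∙ v).mkQ x) - x) = 0 := by rw [map_sub, hσ', sub_self]
      rw [← LinearMap.mem_ker, Submodule.ker_mkQ] at h1
      obtain ⟨c, hc⟩ := Submodule.mem_span_singleton.1 h1
      obtain ⟨d, hd⟩ := hv f hf
      rw [← sub_eq_zero, ← map_sub, ← map_sub, ← hc, map_smul, hd, ← LinearMap.mem_ker,
        Submodule.ker_mkQ]
      exact Submodule.smul_mem _ _ (Submodule.smul_mem _ _ (Submodule.mem_span_singleton_self v))
    have key2 : ∀ f ∈ W, ∀ y : LinearMap.ker φ, ((ρ (f y) : LinearMap.ker φ) : V) = f y := by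
      intro f hf y
      have : f y ∈ LinearMap.ker φ := hφ' f hf y y.2
      have := hρ' ⟨f y, this⟩
      exact congrArg Subtype.val this
    have hd1 : finrank K (V ⧸ (K ∙ v)) = n := by
      have := Submodule.finrank_quotient_add_finrank (K ∙ v)
      omega
    have hd2 : finrank K (LinearMap.ker φ) = n := by
      have := LinearMap.finrank_range_add_finrank_ker φ
      rw [LinearMap.range_eq_top.2 (LinearMap.surjective hφ0)] at this
      simp at this
      omega
    have b1 := ih _ hd1 (W.map L1) (by
      rintro _ ⟨f, hf, rfl⟩ _ ⟨g, hg, rfl⟩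
      refine LinearMap.ext fun y => ?_
      simp only [Module.End.mul_apply, hL1]
      rw [key1 f hf, key1 g hg]
      exact congrArg (fun h : Module.End K V => (K ∙ v).mkQ (h (σ y))) (hW f hf g hg))
    have b2 := ih _ hd2 (W.map L2) (by
      rintro _ ⟨f, hf, rfl⟩ _ ⟨g, hg, rfl⟩
      refine LinearMap.ext fun y => ?_
      simp only [Module.End.mul_apply, hL2]
      rw [key2 f hf, key2 g hg]
      exact congrArg (fun h : Module.End K V => ρ (h y)) (hW f hf g hg))
    have r1 := finrank_le_of_map W L1
    have r2 := finrank_le_of_map W L2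
    have k1 : ∀ f ∈ W ⊓ LinearMap.ker L1, ∀ x, ∃ c : K, c • v = f x := by
      rintro f ⟨hf, hf0⟩ x
      have := congrArg (fun h => h ((K ∙ v).mkQ x)) (LinearMap.mem_ker.1 hf0)
      simp only [hL1, key1 f hf] at this
      have h2 : (K ∙ v).mkQ (f x) = 0 := this
      rw [← LinearMap.mem_ker, Submodule.ker_mkQ] at h2
      exact Submodule.mem_span_singleton.1 h2
    have k2 : ∀ f ∈ W ⊓ LinearMap.ker L2, ∀ x, φ x = 0 → f x = 0 := by
      rintro f ⟨hf, hf0⟩ x hx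
      have := congrArg (fun h => ((h ⟨x, hx⟩ : LinearMap.ker φ) : V)) (LinearMap.mem_ker.1 hf0)
      simp only [hL2] at this
      exact (key2 f hf ⟨x, hx⟩).symm.trans this
    let T1 : Module.End K V →ₗ[K] Dual K V :=
      { toFun := fun f => ψ ∘ₗ f
        map_add' := by intros; ext; simp
        map_smul' := by intros; ext; simp }
    let T2 : Module.End K V →ₗ[K] V := LinearMap.applyₗ s
    have f1 := finrank_le_of_map (W ⊓ LinearMap.ker L1) T1
    have f2 := finrank_le_of_map (W ⊓ LinearMap.ker L2) T2
    have z1 : (W ⊓ LinearMap.ker L1) ⊓ LinearMap.ker T1 = ⊥ := by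
      rw [eq_bot_iff]
      rintro f ⟨hf, hf0⟩
      refine LinearMap.ext fun x => ?_
      obtain ⟨c, hc⟩ := k1 f hf x
      have : ψ (f x) = 0 := congrArg (fun h => h x) (LinearMap.mem_ker.1 hf0)
      rw [← hc] at this ⊢
      simp [hψ] at this
      simp [this]
    have z2 : (W ⊓ LinearMap.ker L2) ⊓ LinearMap.ker T2 = ⊥ := by
      rw [eq_bot_iff]
      rintro f ⟨hf, hf0⟩
      refine LinearMap.ext fun x => ?_
      have hs0 : f s = 0 := hf0
      have := k2 f hf (x - φ x • s) (by simp [hs])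
      simpa [hs0] using this
    rw [z1, finrank_bot] at f1
    rw [z2, finrank_bot] at f2
    have hle : (W ⊓ LinearMap.ker L1).map T1 ≤
        ((W ⊓ LinearMap.ker L2).map T2).dualAnnihilator := by
      rintro _ ⟨f, hf, rfl⟩
      rw [Submodule.mem_dualAnnihilator]
      rintro _ ⟨g, hg, rfl⟩
      change ψ (f (g s)) = 0
      have : f (g s) = g (f s) :=
        congrArg (fun h : Module.End K V => h s) (hW f hf.1 g hg.1)
      obtain ⟨c, hc⟩ := k1 f hf s
      rw [this, ← hc, map_smul, k2 g hg v hφv, smul_zero, map_zero]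
    have q1 := Submodule.finrank_mono hle
    have q2 := Subspace.finrank_add_finrank_dualAnnihilator_eq ((W ⊓ LinearMap.ker L2).map T2)
    exact schur_step_arith n _ _ _ (by omega) (by omega) (by omega :
      finrank K ↥(W ⊓ LinearMap.ker L1) + finrank K ↥(W ⊓ LinearMap.ker L2) ≤ n + 1)

open Module in
theorem schur_matrix {F : Type*} [Field F] (n : ℕ) (W : Submodule F (Matrix (Fin n) (Fin n) F))
    (hW : ∀ f ∈ W, ∀ g ∈ W, f * g = g * f) : finrank F W ≤ n ^ 2 / 4 + 1 := by
  let K := AlgebraicClosure F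
  let b := Module.finBasis F W
  let B : Fin (finrank F W) → Matrix (Fin n) (Fin n) K :=
    fun i => (b i : Matrix (Fin n) (Fin n) F).map (algebraMap F K)
  have hcomm : ∀ i j, B i * B j = B j * B i := by
    intro i j
    simp only [B]
    rw [← Matrix.map_mul, ← Matrix.map_mul, hW _ (b i).2 _ (b j).2]
  have hB : LinearIndependent K B := by
    rw [Fintype.linearIndependent_iff]
    intro c hc i
    rw [← Module.forall_dual_apply_eq_zero_iff F]
    intro l
    have hbi := Fintype.linearIndependent_iff.1 b.linearIndependent (fun i => l (c i))
    refine hbi ?_ i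
    apply Subtype.ext
    ext x y
    have h1 := congrArg l (congrFun (congrFun hc x) y)
    simp only [B, Matrix.sum_apply, Matrix.smul_apply, Matrix.map_apply, Matrix.zero_apply,
      map_sum, map_zero, smul_eq_mul] at h1
    simp only [AddSubmonoidClass.coe_finsetSum, Submodule.coe_smul, Matrix.sum_apply,
      Matrix.smul_apply, smul_eq_mul, ZeroMemClass.coe_zero, Matrix.zero_apply]
    rw [← h1]
    refine Finset.sum_congr rfl fun j _ => ?_
    rw [mul_comm (c j), ← Algebra.smul_def, map_smul, smul_eq_mul, mul_comm]
  let e := (Matrix.toLinAlgEquiv' : Matrix (Fin n) (Fin n) K ≃ₐ[K] _)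
  have hB' : LinearIndependent K (fun i => e (B i)) :=
    hB.map' e.toLinearMap (LinearMap.ker_eq_bot.2 e.injective)
  have hc : ∀ i j, e (B i) * e (B j) = e (B j) * e (B i) := by
    intro i j
    rw [← map_mul, ← map_mul, hcomm]
  have := schur_closed (K := K) n (Fin n → K) (by simp)
    (Submodule.span K (Set.range fun i => e (B i))) (by
      intro f hf g hg
      induction hf, hg using Submodule.span_induction₂ with
      | mem_mem x y hx hy =>
        obtain ⟨i, rfl⟩ := hx
        obtain ⟨j, rfl⟩ := hy
        exact hc i j
      | zero_left => simp
      | zero_right => simp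
      | add_left x y z _ _ _ h1 h2 => rw [add_mul, mul_add, h1, h2]
      | add_right x y z _ _ _ h1 h2 => rw [add_mul, mul_add, h1, h2]
      | smul_left r x y _ _ h => rw [smul_mul_assoc, mul_smul_comm, h]
      | smul_right r x y _ _ h => rw [smul_mul_assoc, mul_smul_comm, h])
  rw [finrank_span_eq_card hB'] at this
  simpa using this

theorem upper_bound {F : Type} [Field F] [Fintype F] (n k : ℕ) :
    Nat.card {T : Fin k → Matrix (Fin n) (Fin n) F // ∀ i j, Commute (T i) (T j)} ≤
      Nat.card (Submodule F (Matrix (Fin n) (Fin n) F)) *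
        Fintype.card F ^ ((n ^ 2 / 4 + 1) * k) := by
  classical
  let S := {W : Submodule F (Matrix (Fin n) (Fin n) F) // ∀ f ∈ W, ∀ g ∈ W, f * g = g * f}
  have : Finite (Submodule F (Matrix (Fin n) (Fin n) F)) :=
    Finite.of_injective _ (SetLike.coe_injective)
  have : Fintype S := Fintype.ofFinite _
  let Φ : {T : Fin k → Matrix (Fin n) (Fin n) F // ∀ i j, Commute (T i) (T j)} →
      Σ W : S, (Fin k → W.1) := fun T =>
    ⟨⟨Submodule.span F (Set.range T.1), by
      intro f hf g hg
      induction hf, hg using Submodule.span_induction₂ with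
      | mem_mem x y hx hy =>
        obtain ⟨i, rfl⟩ := hx
        obtain ⟨j, rfl⟩ := hy
        exact T.2 i j
      | zero_left => simp
      | zero_right => simp
      | add_left x y z _ _ _ h1 h2 => rw [add_mul, mul_add, h1, h2]
      | add_right x y z _ _ _ h1 h2 => rw [add_mul, mul_add, h1, h2]
      | smul_left r x y _ _ h => rw [smul_mul_assoc, mul_smul_comm, h]
      | smul_right r x y _ _ h => rw [smul_mul_assoc, mul_smul_comm, h]⟩,
      fun i => ⟨T.1 i, Submodule.subset_span ⟨i, rfl⟩⟩⟩
  have hΦ : Function.Injective Φ := by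
    let G : (Σ W : S, (Fin k → W.1)) → (Fin k → Matrix (Fin n) (Fin n) F) :=
      fun p i => (p.2 i : Matrix (Fin n) (Fin n) F)
    intro T T' h
    exact Subtype.ext (congrArg G h)
  have hcW : ∀ W : S, Nat.card (Fin k → W.1) ≤ Fintype.card F ^ ((n ^ 2 / 4 + 1) * k) := by
    intro W
    rw [Nat.card_fun, Nat.card_fin, Module.natCard_eq_pow_finrank (K := F), Nat.card_eq_fintype_card,
      ← pow_mul]
    exact Nat.pow_le_pow_right Fintype.card_pos
      (Nat.mul_le_mul_right _ (schur_matrix n W.1 W.2))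
  calc _ ≤ Nat.card (Σ W : S, (Fin k → W.1)) := Nat.card_le_card_of_injective Φ hΦ
    _ = ∑ W : S, Nat.card (Fin k → W.1) := Nat.card_sigma
    _ ≤ ∑ W : S, Fintype.card F ^ ((n ^ 2 / 4 + 1) * k) := Finset.sum_le_sum fun W _ => hcW W
    _ = Nat.card S * Fintype.card F ^ ((n ^ 2 / 4 + 1) * k) := by
      simp [Nat.card_eq_fintype_card]
    _ ≤ _ := Nat.mul_le_mul_right _ (Nat.card_le_card_of_injective _ Subtype.val_injective)

theorem lower_bound {F : Type} [Field F] [Fintype F] (n k : ℕ) (hn : 1 ≤ n) :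
    Fintype.card F ^ ((n ^ 2 / 4 + 1) * k) ≤
    Nat.card {T : Fin k → Matrix (Fin n) (Fin n) F // ∀ i j, Commute (T i) (T j)} := by
  classical
  obtain ⟨a, b, hab, hb, hm⟩ : ∃ a b, a + b = n ∧ 1 ≤ b ∧ a * b = n ^ 2 / 4 := by
    obtain ⟨m, rfl | rfl⟩ := Nat.even_or_odd' n
    · refine ⟨m, m, by omega, by omega, ?_⟩
      rw [show (2 * m) ^ 2 = 4 * (m * m) by ring]; omega
    · refine ⟨m, m + 1, by omega, by omega, ?_⟩
      rw [show (2 * m + 1) ^ 2 = 4 * (m * m + m) + 1 by ring, mul_add]; omega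
  subst hab
  let e : Matrix (Fin a ⊕ Fin b) (Fin a ⊕ Fin b) F ≃ₐ[F] Matrix (Fin (a + b)) (Fin (a + b)) F :=
    Matrix.reindexAlgEquiv F F finSumFinEquiv
  let M : F × Matrix (Fin a) (Fin b) F → Matrix (Fin a ⊕ Fin b) (Fin a ⊕ Fin b) F :=
    fun p => Matrix.fromBlocks (p.1 • 1) p.2 0 (p.1 • 1)
  have hM : ∀ p p', M p * M p' = M p' * M p := by
    intro p p'
    simp only [M, Matrix.fromBlocks_multiply]
    simp [smul_smul, mul_comm, add_comm]
  have hinj : Function.Injective M := by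
    intro p p' h
    obtain ⟨-, h2, -, h4⟩ := Matrix.fromBlocks_inj.1 h
    refine Prod.ext ?_ h2
    have := congrFun (congrFun h4 ⟨0, hb⟩) ⟨0, hb⟩
    simpa using this
  let Φ : (Fin k → F × Matrix (Fin a) (Fin b) F) →
      {T : Fin k → Matrix (Fin (a + b)) (Fin (a + b)) F // ∀ i j, Commute (T i) (T j)} :=
    fun p => ⟨fun i => e (M (p i)), fun i j => by
      change e _ * e _ = e _ * e _
      rw [← map_mul, ← map_mul, hM]⟩
  have hΦ : Function.Injective Φ := by
    intro p p' h
    funext i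
    exact hinj (e.injective (congrFun (congrArg Subtype.val h) i))
  have := Nat.card_le_card_of_injective Φ hΦ
  refine le_trans (le_of_eq ?_) this
  rw [← hm, Nat.card_fun, Nat.card_prod, Nat.card_fin, Nat.card_eq_fintype_card,
    Nat.card_eq_fintype_card]
  have : Fintype.card (Matrix (Fin a) (Fin b) F) = Fintype.card F ^ (a * b) := by
    change Fintype.card (Fin a → Fin b → F) = _
    simp [← pow_mul, mul_comm]
  rw [this, ← pow_succ', ← pow_mul]

/-- With `m(n) = ⌊n²/4⌋ + 1`, the total number `C(n,k,q)` of `k`-tuples of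
pairwise commuting `n × n` matrices over `F_q` satisfies
`D₁ q^(m(n)k) ≤ C(n,k,q) ≤ D₂ q^(m(n)k)` for all large `k`. -/
theorem stmt17 (n q : ℕ) (hn : 1 ≤ n) (F : Type) [Field F] [Fintype F]
    (hF : Fintype.card F = q) :
    ∃ D₁ D₂ : ℝ, 0 < D₁ ∧ 0 < D₂ ∧ ∃ K : ℕ, ∀ k : ℕ, K ≤ k →
      D₁ * (q : ℝ) ^ ((n ^ 2 / 4 + 1) * k) ≤
        (Nat.card {T : Fin k → Matrix (Fin n) (Fin n) F //
          ∀ i j, Commute (T i) (T j)} : ℝ) ∧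
      (Nat.card {T : Fin k → Matrix (Fin n) (Fin n) F //
          ∀ i j, Commute (T i) (T j)} : ℝ) ≤
        D₂ * (q : ℝ) ^ ((n ^ 2 / 4 + 1) * k) := by
  subst hF
  have : Finite (Submodule F (Matrix (Fin n) (Fin n) F)) :=
    Finite.of_injective _ (SetLike.coe_injective)
  refine ⟨1, Nat.card (Submodule F (Matrix (Fin n) (Fin n) F)), one_pos,
    by exact_mod_cast Nat.card_pos, 0, fun k _ => ⟨?_, ?_⟩⟩
  · rw [one_mul]
    exact_mod_cast lower_bound n k hn
  · exact_mod_cast upper_bound n k
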